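/- Let d, n ∈ ℕ, let x⁽¹⁾,…,x⁽ⁿ⁾ ∈ [0,1]^d be arbitrary nodes and a₁,…,aₙ ∈ ℝ arbitrary weights. For coefficients c : {0,1,2}^d → ℝ define f_c : [0,1]^d → ℝ by f_c(x) = Σ_{j ∈ {0,1,2}^d} c_j ∏_{i=1}^d b_{j_i}(x_i), where b₀(t) = 1, b₁(t) = cos(2πt), b₂(t) = sin(2πt). Then sup{ ( ∫_{[0,1]^d} f_c(x) dx − Σ_{k=1}^n a_k f_c(x⁽ᵏ⁾) )² : Σ_j c_j² ≤ 1 } ≥ 1 − n · 2^{−d}. (Note that ∫_{[0,1]^d} f_c = c_{(0,…,0)}.) In particular, to achieve worst-case error √2/2 on this class one needs at least 2^{d−1} function values, so the curse of dimensionality holds. -/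

import Mathlib

open MeasureTheory

/-- The closed unit cube `[0,1]^d`. -/
def cube01 (d : ℕ) : Set (Fin d → ℝ) := Set.univ.pi fun _ => Set.Icc 0 1

/-- The univariate basis functions `b₀ = 1`, `b₁ = cos(2πt)`, `b₂ = sin(2πt)`. -/
noncomputable def trigBasis : Fin 3 → ℝ → ℝ :=
  ![fun _ => 1, fun t => Real.cos (2 * Real.pi * t), fun t => Real.sin (2 * Real.pi * t)]

/-- The function `f_c(x) = Σ_{j ∈ {0,1,2}^d} c_j ∏_i b_{j_i}(x_i)`. -/
noncomputable def trigTensor (d : ℕ) (c : (Fin d → Fin 3) → ℝ) (x : Fin d → ℝ) : ℝ :=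
  ∑ j : Fin d → Fin 3, c j * ∏ i, trigBasis (j i) (x i)

section TraceInequality

open Matrix

/-- For a positive semidefinite `M` and `D = diagonal a`, the trace inequality
`tr (D M) ^ 2 ≤ n * tr (D M D M)` holds. -/
theorem sq_sum_mul_diag_le_card_mul_sum {ι : Type*} [Fintype ι]
    {M : Matrix ι ι ℝ} (hM : M.PosSemidef) (a : ι → ℝ) :
    (∑ k, a k * M k k) ^ 2 ≤ Fintype.card ι * ∑ k, ∑ l, a k * a l * M k l ^ 2 := by
  classical
  obtain ⟨B, rfl⟩ : ∃ B : Matrix ι ι ℝ, M = Bᵀ * B := by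
    open scoped MatrixOrder in
    obtain ⟨B, hB⟩ := CStarAlgebra.nonneg_iff_eq_star_mul_self.mp hM.nonneg
    exact ⟨B, by simpa [star_eq_conjTranspose] using hB⟩
  have htrace : ∑ k, a k * (Bᵀ * B) k k = ∑ i, ∑ k, a k * B i k ^ 2 := by
    simp only [mul_apply, transpose_apply, Finset.mul_sum]
    rw [Finset.sum_comm]
    simp only [sq]
  have hfrob : ∑ k, ∑ l, a k * a l * (Bᵀ * B) k l ^ 2
      = ∑ i, ∑ j, (∑ k, a k * B i k * B j k) ^ 2 := by
    simp only [mul_apply, transpose_apply, sq, Finset.sum_mul_sum]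
    simp only [Finset.mul_sum]
    rw [Finset.sum_congr rfl fun k _ => Finset.sum_comm, Finset.sum_comm]
    refine Finset.sum_congr rfl fun i _ => ?_
    rw [Finset.sum_congr rfl fun k _ => Finset.sum_comm, Finset.sum_comm]
    refine Finset.sum_congr rfl fun j _ => Finset.sum_congr rfl fun k _ =>
      Finset.sum_congr rfl fun l _ => ?_
    ring
  rw [htrace, hfrob]
  calc (∑ i, ∑ k, a k * B i k ^ 2) ^ 2
      ≤ Fintype.card ι * ∑ i, (∑ k, a k * B i k ^ 2) ^ 2 := by
        simpa using sq_sum_le_card_mul_sum_sq (s := Finset.univ)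
          (f := fun i => ∑ k, a k * B i k ^ 2)
    _ ≤ _ := by
        gcongr with i
        refine le_trans (le_of_eq ?_) (Finset.single_le_sum
          (f := fun j => (∑ k, a k * B i k * B j k) ^ 2)
          (fun j _ => sq_nonneg _) (Finset.mem_univ i))
        simp only [sq, mul_assoc]

end TraceInequality

/-- The matrix with entries `∏ i, cos (x k i - x l i)` is a Gram matrix. -/
theorem posSemidef_prod_cos_sub {ι κ : Type*} [Fintype ι] [Fintype κ] (x : κ → ι → ℝ) :
    (Matrix.of fun k l => ∏ i, Real.cos (x k i - x l i)).PosSemidef := by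
  classical
  let V : Matrix (ι → Fin 2) κ ℝ :=
    Matrix.of fun e k => ∏ i, ![Real.cos (x k i), Real.sin (x k i)] (e i)
  convert Matrix.posSemidef_conjTranspose_mul_self V using 1
  ext k l
  simp only [V, Matrix.mul_apply, Matrix.conjTranspose_apply, Matrix.of_apply, star_trivial,
    ← Finset.prod_mul_distrib]
  rw [← Fintype.prod_sum fun i e =>
    ![Real.cos (x k i), Real.sin (x k i)] e * ![Real.cos (x l i), Real.sin (x l i)] e]
  simp [Real.cos_sub]

theorem sum_trigBasis_mul (s t : ℝ) :
    ∑ j, trigBasis j s * trigBasis j t = 2 * Real.cos (Real.pi * s - Real.pi * t) ^ 2 := by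
  rw [Real.cos_sq, mul_sub, Real.cos_sub, Fin.sum_univ_three]
  simp [trigBasis]
  ring_nf

/-- The reproducing kernel of the trigonometric tensor product space. -/
theorem sum_prod_trigBasis_mul {d : ℕ} (x y : Fin d → ℝ) :
    ∑ j : Fin d → Fin 3, (∏ i, trigBasis (j i) (x i)) * ∏ i, trigBasis (j i) (y i)
      = 2 ^ d * (∏ i, Real.cos (Real.pi * x i - Real.pi * y i)) ^ 2 := by
  simp only [← Finset.prod_mul_distrib]
  rw [← Fintype.prod_sum fun i j => trigBasis j (x i) * trigBasis j (y i)]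
  simp [sum_trigBasis_mul, Finset.prod_mul_distrib, Finset.prod_pow]

theorem continuous_trigBasis (j : Fin 3) : Continuous (trigBasis j) := by
  fin_cases j <;> simp [trigBasis] <;> fun_prop

theorem setIntegral_trigBasis (j : Fin 3) :
    ∫ t in Set.Icc (0 : ℝ) 1, trigBasis j t = if j = 0 then 1 else 0 := by
  rw [integral_Icc_eq_integral_Ioc, ← intervalIntegral.integral_of_le zero_le_one]
  have h2 : (2 * Real.pi) ≠ 0 := by positivity
  fin_cases j
  · simp [trigBasis]
  · simp [trigBasis, intervalIntegral.integral_comp_mul_left (fun t => Real.cos t) h2]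
  · simp [trigBasis, intervalIntegral.integral_comp_mul_left (fun t => Real.sin t) h2]

theorem setIntegral_trigTensor (d : ℕ) (c : (Fin d → Fin 3) → ℝ) :
    ∫ t in cube01 d, trigTensor d c t = c 0 := by
  have hvol : (volume : Measure (Fin d → ℝ)).restrict (cube01 d)
      = Measure.pi fun _ => volume.restrict (Set.Icc 0 1) := by
    rw [volume_pi, cube01, Measure.restrict_pi_pi]
  have hint (j : Fin d → Fin 3) :
      Integrable (fun t : Fin d → ℝ => c j * ∏ i, trigBasis (j i) (t i))
        (Measure.pi fun _ => volume.restrict (Set.Icc 0 1)) :=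
    (Integrable.fintype_prod fun i =>
      ((continuous_trigBasis (j i)).continuousOn.integrableOn_Icc)).const_mul _
  simp only [trigTensor]
  rw [hvol, integral_finsetSum _ fun j _ => hint j, Finset.sum_eq_single 0]
  · rw [integral_const_mul, integral_fintype_prod_eq_prod fun i => trigBasis ((0 : Fin d → Fin 3) i)]
    simp [setIntegral_trigBasis]
  · intro j _ hj
    obtain ⟨i, hi⟩ := Function.ne_iff.mp hj
    rw [integral_const_mul, integral_fintype_prod_eq_prod fun i => trigBasis (j i),
      Finset.prod_eq_zero (Finset.mem_univ i), mul_zero]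
    rw [setIntegral_trigBasis]
    exact if_neg hi
  · simp

/-- The coefficients of the Riesz representer of the quadrature error. -/
noncomputable def errorRepresenter {d n : ℕ} (x : Fin n → Fin d → ℝ) (a : Fin n → ℝ)
    (j : Fin d → Fin 3) : ℝ :=
  (if j = 0 then 1 else 0) - ∑ k, a k * ∏ i, trigBasis (j i) (x k i)

theorem quadrature_error_eq_sum {d n : ℕ} (x : Fin n → Fin d → ℝ) (a : Fin n → ℝ)
    (c : (Fin d → Fin 3) → ℝ) :
    (∫ t in cube01 d, trigTensor d c t) - ∑ k, a k * trigTensor d c (x k)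
      = ∑ j, c j * errorRepresenter x a j := by
  rw [setIntegral_trigTensor]
  simp only [errorRepresenter, mul_sub, Finset.sum_sub_distrib, trigTensor, Finset.mul_sum]
  rw [Finset.sum_comm]
  simp [mul_left_comm]

theorem sum_errorRepresenter_sq {d n : ℕ} (x : Fin n → Fin d → ℝ) (a : Fin n → ℝ) :
    ∑ j, errorRepresenter x a j ^ 2 = 1 - 2 * ∑ k, a k + 2 ^ d *
      ∑ k, ∑ l, a k * a l * (∏ i, Real.cos (Real.pi * x k i - Real.pi * x l i)) ^ 2 := by
  have hquad : ∑ j : Fin d → Fin 3, (∑ k, a k * ∏ i, trigBasis (j i) (x k i)) ^ 2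
      = 2 ^ d * ∑ k, ∑ l,
        a k * a l * (∏ i, Real.cos (Real.pi * x k i - Real.pi * x l i)) ^ 2 := by
    simp only [sq (∑ k, _), Finset.sum_mul_sum]
    rw [Finset.sum_comm, Finset.mul_sum]
    refine Finset.sum_congr rfl fun k _ => ?_
    rw [Finset.sum_comm, Finset.mul_sum]
    refine Finset.sum_congr rfl fun l _ => ?_
    rw [mul_left_comm, ← sum_prod_trigBasis_mul, Finset.mul_sum]
    exact Finset.sum_congr rfl fun j _ => by ring
  simp only [errorRepresenter, sub_sq, Finset.sum_add_distrib, Finset.sum_sub_distrib, hquad]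
  simp [trigBasis, mul_assoc, ← Finset.mul_sum]

theorem one_sub_le_sum_errorRepresenter_sq {d n : ℕ} (hn : 0 < n) (x : Fin n → Fin d → ℝ)
    (a : Fin n → ℝ) : 1 - (n : ℝ) / 2 ^ d ≤ ∑ j, errorRepresenter x a j ^ 2 := by
  have h := sq_sum_mul_diag_le_card_mul_sum
    (posSemidef_prod_cos_sub fun k i => Real.pi * x k i) a
  simp only [Matrix.of_apply, sub_self, Real.cos_zero, Finset.prod_const_one, mul_one,
    Fintype.card_fin] at h
  rw [sum_errorRepresenter_sq]
  set A := ∑ k, a k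
  set Q := ∑ k, ∑ l, a k * a l * (∏ i, Real.cos (Real.pi * x k i - Real.pi * x l i)) ^ 2
  have hn' : (0 : ℝ) < n := by exact_mod_cast hn
  have hp : (0 : ℝ) < 2 ^ d := by positivity
  have hQ : A ^ 2 / n ≤ Q := by rwa [div_le_iff₀' hn']
  have hsq : 2 ^ d * (A ^ 2 / n) - 2 * A + n / 2 ^ d = (2 ^ d * A - n) ^ 2 / (n * 2 ^ d) := by
    field_simp
    ring
  have hnonneg : 0 ≤ (2 ^ d * A - n) ^ 2 / (n * 2 ^ d) := by positivity
  nlinarith [mul_le_mul_of_nonneg_left hQ hp.le]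

/-- The squared norm of a functional on a finite-dimensional Euclidean space is attained on
the unit ball. -/
theorem exists_sum_sq_le_one_sq_sum_mul_eq {ι : Type*} [Fintype ι] (w : ι → ℝ) :
    ∃ c : ι → ℝ, ∑ j, c j ^ 2 ≤ 1 ∧ (∑ j, c j * w j) ^ 2 = ∑ j, w j ^ 2 := by
  obtain h | h := (Finset.sum_nonneg fun j _ => sq_nonneg (w j) :
    0 ≤ ∑ j, w j ^ 2).eq_or_lt
  · exact ⟨0, by simp, by simp [← h]⟩
  · have hs := Real.sq_sqrt h.le
    refine ⟨fun j => w j / √(∑ j, w j ^ 2), ?_, ?_⟩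
    · simp only [div_pow, ← Finset.sum_div, hs, div_self h.ne', le_refl]
    · simp only [div_mul_eq_mul_div, ← sq, ← Finset.sum_div, div_pow, hs]
      field_simp

/-- Vybíral's lower bound: for any `n`-point quadrature with arbitrary weights, the worst
case squared error over the unit ball `Σ c_j² ≤ 1` of the trigonometric tensor product space
is at least `1 - n·2^{-d}`; in particular, worst-case error `√2/2` requires `n ≥ 2^{d-1}`. -/
theorem trig_tensor_lower_bound (d n : ℕ) (hd : 0 < d) (hn : 0 < n)
    (x : Fin n → Fin d → ℝ) (hx : ∀ k, x k ∈ cube01 d) (a : Fin n → ℝ) :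
    (1 - (n : ℝ) / 2 ^ d ≤
      sSup {y : ℝ | ∃ c : (Fin d → Fin 3) → ℝ, (∑ j, c j ^ 2) ≤ 1 ∧
        y = ((∫ t in cube01 d, trigTensor d c t) - ∑ k, a k * trigTensor d c (x k)) ^ 2}) ∧
    ((∀ c : (Fin d → Fin 3) → ℝ, (∑ j, c j ^ 2) ≤ 1 →
        |(∫ t in cube01 d, trigTensor d c t) - ∑ k, a k * trigTensor d c (x k)|
          ≤ Real.sqrt 2 / 2) →
      2 ^ (d - 1) ≤ n) := by
  obtain ⟨c, hc, hcw⟩ := exists_sum_sq_le_one_sq_sum_mul_eq (errorRepresenter x a)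
  have hlow := one_sub_le_sum_errorRepresenter_sq hn x a
  rw [← hcw] at hlow
  simp only [quadrature_error_eq_sum]
  refine ⟨hlow.trans (le_csSup ⟨∑ j, errorRepresenter x a j ^ 2, ?_⟩ ⟨c, hc, rfl⟩), fun h => ?_⟩
  · rintro _ ⟨b, hb, rfl⟩
    exact (Finset.sum_mul_sq_le_sq_mul_sq _ _ _).trans
      (mul_le_of_le_one_left (Finset.sum_nonneg fun j _ => sq_nonneg _) hb)
  · have hhalf : (∑ j, c j * errorRepresenter x a j) ^ 2 ≤ 1 / 2 := by
      calc (∑ j, c j * errorRepresenter x a j) ^ 2 ≤ (√2 / 2) ^ 2 :=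
            sq_le_sq' (abs_le.mp (h c hc)).1 (abs_le.mp (h c hc)).2
        _ = 1 / 2 := by rw [div_pow, Real.sq_sqrt zero_le_two]; norm_num
    have hdiv : 1 / 2 ≤ (n : ℝ) / 2 ^ d := by linarith
    rw [le_div_iff₀ (by positivity)] at hdiv
    have hpow : (2 : ℝ) ^ d = 2 * 2 ^ (d - 1) := by
      rw [← pow_succ', Nat.sub_add_cancel hd]
    have hreal : (2 : ℝ) ^ (d - 1) ≤ n := by linarith
    exact_mod_cast hreal
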